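/- arXiv:2211.14089 — 2 statements merged into one kernel-verified Lean document; each statement's English description precedes it below -/
import Mathlib

section
/- (Kempf's curve lemma) Let k be an algebraically closed field, let X be an integral quasi-projective scheme over k of dimension at least 1, let U be a nonempty open subset of X, and let p be a closed point of X. Then there exists an irreducible closed subset C of the underlying topological space of X with topological Krull dimension equal to 1 such that p ∈ C and C ∩ U ≠ ∅. -/
open AlgebraicGeometry CategoryTheory

attribute [local instance] MvPolynomial.gradedAlgebra

/-- Projective `n`-space over a field `k`, defined as `Proj k[x₀, …, xₙ]`. -/
noncomputable def ProjectiveSpace (k : Type) [Field k] (n : ℕ) : Scheme :=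
  Proj (MvPolynomial.homogeneousSubmodule (Fin (n + 1)) k)

/-- The structure morphism `ℙⁿ_k ⟶ Spec k`. -/
noncomputable def ProjectiveSpace.structureMap (k : Type) [Field k] (n : ℕ) :
    ProjectiveSpace k n ⟶ Spec (CommRingCat.of k) :=
  Proj.toSpecZero _ ≫ Spec.map (CommRingCat.ofHom (algebraMap k _))

/-- A scheme `X` over `k` (with structure morphism `sX`) is quasi-projective over `k` if it
admits an immersion (locally closed immersion) into some projective space `ℙⁿ_k` over `k`. -/
def IsQuasiProjectiveOver (k : Type) [Field k] {X : Scheme}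
    (sX : X ⟶ Spec (CommRingCat.of k)) : Prop :=
  ∃ (n : ℕ) (i : X ⟶ ProjectiveSpace k n),
    IsImmersion i ∧ i ≫ ProjectiveSpace.structureMap k n = sX

theorem MvPolynomial.height_eq_of_isMaximal {k : Type*} [Field k] {n : ℕ}
    (m : Ideal (MvPolynomial (Fin n) k)) [m.IsMaximal] : m.height = n := by
  induction n with
  | zero =>
    have h := MvPolynomial.ringKrullDim_of_isNoetherianRing (R := k) (ι := Fin 0)
    have h' := Ideal.height_le_ringKrullDim_of_ne_top (I := m) Ideal.IsPrime.ne_top'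
    rw [h] at h'
    simpa using h'
  | succ n ih =>
    let e := MvPolynomial.finSuccEquiv k n
    let P : Ideal (Polynomial (MvPolynomial (Fin n) k)) := m.map e.toRingEquiv
    have : P.IsMaximal := Ideal.map_isMaximal_of_equiv e.toRingEquiv
    have : (P.comap Polynomial.C).IsMaximal := Polynomial.isMaximal_comap_C_of_isJacobsonRing P
    have : P.LiesOver (P.comap Polynomial.C) := ⟨rfl⟩
    rw [← RingEquiv.height_map e.toRingEquiv m]
    change P.height = _
    rw [Polynomial.height_eq_height_add_one (P.comap Polynomial.C) P, ih]
    simp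

theorem Ideal.exists_forall_isMaximal_height_eq (k : Type*) {B : Type*} [Field k] [CommRing B]
    [IsDomain B] [Algebra k B] [Algebra.FiniteType k B] :
    ∃ n : ℕ, ∀ m : Ideal B, m.IsMaximal → m.height = n := by
  obtain ⟨s, g, hg, hfin⟩ := exists_finite_inj_algHom_of_fg k B
  refine ⟨s, fun m hm ↦ ?_⟩
  algebraize [g.toRingHom]
  have : FaithfulSMul (MvPolynomial (Fin s) k) B :=
    (faithfulSMul_iff_algebraMap_injective _ _).mpr hg
  have : Module.Finite (MvPolynomial (Fin s) k) B := hfin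
  have : IsNoetherianRing B := Algebra.FiniteType.isNoetherianRing k B
  let n := m.under (MvPolynomial (Fin s) k)
  have : n.IsMaximal := Ideal.isMaximal_comap_of_isIntegral_of_isMaximal m
  rw [Ideal.height_eq_height_add_of_liesOver_of_hasGoingDown n m,
    MvPolynomial.height_eq_of_isMaximal n]
  convert add_zero _
  have hnm : n.map (algebraMap _ B) ≤ m := Ideal.map_comap_le
  have : (m.map (Ideal.Quotient.mk (n.map (algebraMap _ B)))).IsPrime :=
    Ideal.map_isPrime_of_surjective Ideal.Quotient.mk_surjective (by simpa using hnm)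
  rw [Ideal.height_eq_zero_iff]
  have hmin := Ideal.IsIntegral.mem_minimalPrimes_map_under (R := MvPolynomial (Fin s) k) m
  change _ ∈ (⊥ : Ideal _).minimalPrimes
  rw [← Ideal.map_quotient_self, Ideal.minimalPrimes_map_of_surjective
    Ideal.Quotient.mk_surjective, Ideal.mk_ker, sup_idem]
  exact ⟨m, hmin, rfl⟩

theorem PrimeSpectrum.comap_mk_covBy_comap_mk_iff {A : Type*} [CommRing A] {I : Ideal A}
    {q q' : PrimeSpectrum (A ⧸ I)} :
    comap (Ideal.Quotient.mk I) q ⋖ comap (Ideal.Quotient.mk I) q' ↔ q ⋖ q' := by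
  let e := I.primeSpectrumQuotientOrderIsoZeroLocus
  have hc : Set.OrdConnected (Set.range (Subtype.val : zeroLocus (I : Set A) → _)) := by
    rw [Subtype.range_val]
    exact ⟨fun a ha b hb c hc ↦ Set.Subset.trans ha hc.1⟩
  exact (Set.OrdConnected.apply_covBy_apply_iff (OrderEmbedding.subtype _) hc).trans
    (apply_covBy_apply_iff e)

theorem PrimeSpectrum.exists_comap_mk_eq {A : Type*} [CommRing A] {I : Ideal A}
    {m : PrimeSpectrum A} (h : I ≤ m.asIdeal) :
    ∃ q : PrimeSpectrum (A ⧸ I), comap (Ideal.Quotient.mk I) q = m := by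
  let e := I.primeSpectrumQuotientOrderIsoZeroLocus
  exact ⟨e.symm ⟨m, h⟩, congr_arg Subtype.val (e.apply_symm_apply ⟨m, h⟩)⟩

theorem PrimeSpectrum.bot_covBy_iff_height_eq_one {B : Type*} [CommRing B] [IsDomain B]
    {q : PrimeSpectrum B} : ⊥ ⋖ q ↔ q.asIdeal.height = 1 := by
  constructor
  · refine fun h ↦ le_antisymm (Ideal.height_le_iff.mpr fun I hI hIq ↦ ?_) ?_
    · have : (⟨I, hI⟩ : PrimeSpectrum B) = ⊥ := by
        by_contra hI0
        exact h.2 (bot_lt_iff_ne_bot.mpr hI0) hIq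
      have hI0 : I = ⊥ := congr_arg asIdeal this
      simp [hI0]
    · rw [Order.one_le_iff_ne_zero, Ne, Ideal.height_eq_zero_iff_eq_bot]
      exact fun h0 ↦ h.lt.ne (PrimeSpectrum.ext h0).symm
  · refine fun h ↦ ⟨bot_lt_iff_ne_bot.mpr ?_, fun r hr hrq ↦ ?_⟩
    · rintro rfl
      exact Ideal.ne_bot_of_height_eq_one h rfl
    · have := Ideal.height_le_iff (n := 1).mp h.le r.asIdeal r.isPrime hrq
      rw [Nat.cast_one, Order.lt_one_iff, Ideal.height_eq_zero_iff_eq_bot] at this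
      exact hr.ne' (PrimeSpectrum.ext this)

theorem PrimeSpectrum.comap_mk_bot {A : Type*} [CommRing A] (P : PrimeSpectrum A) :
    comap (Ideal.Quotient.mk P.asIdeal) ⊥ = P := by
  ext1
  change (⊥ : Ideal _).comap _ = _
  rw [← RingHom.ker_eq_comap_bot, Ideal.mk_ker]

theorem PrimeSpectrum.isMaximal_of_comap {A B : Type*} [CommRing A] [CommRing B] {f : A →+* B}
    (hf : Function.Surjective f) {q : PrimeSpectrum B} (hq : (comap f q).asIdeal.IsMaximal) :
    q.asIdeal.IsMaximal := by
  have := Ideal.map_eq_top_or_isMaximal_of_surjective f hf hq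
  rw [comap_asIdeal, Ideal.map_comap_of_surjective f hf] at this
  exact this.resolve_left q.isPrime.ne_top

theorem PrimeSpectrum.covBy_of_isMaximal (k : Type*) {A : Type*} [Field k] [CommRing A]
    [Algebra k A] [Algebra.FiniteType k A] {P m m' : PrimeSpectrum A} (h : P ⋖ m)
    (hm : m.asIdeal.IsMaximal) (hm' : m'.asIdeal.IsMaximal) (h' : P ≤ m') : P ⋖ m' := by
  obtain ⟨n, hn⟩ := Ideal.exists_forall_isMaximal_height_eq k (B := A ⧸ P.asIdeal)
  obtain ⟨q, rfl⟩ := exists_comap_mk_eq (I := P.asIdeal) h.le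
  obtain ⟨q', rfl⟩ := exists_comap_mk_eq (I := P.asIdeal) h'
  have hq : q.asIdeal.IsMaximal := isMaximal_of_comap Ideal.Quotient.mk_surjective hm
  have hq' : q'.asIdeal.IsMaximal := isMaximal_of_comap Ideal.Quotient.mk_surjective hm'
  nth_rw 1 [← comap_mk_bot P] at h ⊢
  rw [comap_mk_covBy_comap_mk_iff, bot_covBy_iff_height_eq_one] at h ⊢
  rw [hn _ hq', ← hn _ hq, h]

theorem PrimeSpectrum.bot_covBy_of_forall_mem {A : Type*} [CommRing A] [IsDomain A]
    [IsNoetherianRing A] (m : PrimeSpectrum A) (hm : m ≠ ⊥) {f : A} (hf : f ≠ 0)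
    (h : ∀ q : PrimeSpectrum A, q ≠ ⊥ → q < m → f ∈ q.asIdeal) : ⊥ ⋖ m := by
  refine ⟨bot_lt_iff_ne_bot.mpr hm, fun Q hQ hQm ↦ ?_⟩
  have hfQ := h Q hQ.ne' hQm
  have hne (I : Ideal A) (hI : I.IsPrime) {g : A} (hg : g ≠ 0) (hgI : g ∈ I) : I ≠ ⊥ := by
    rintro rfl
    exact hg hgI
  have hfin := Ideal.finite_minimalPrimes_of_isNoetherianRing A (Ideal.span {f})
  have hx : ∃ x ∈ m.asIdeal, ∀ q ∈ (Ideal.span {f}).minimalPrimes, x ∉ q := by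
    by_contra! hcon
    obtain ⟨q, hq, hmq⟩ := (Ideal.subset_union_prime (s := hfin.toFinset) (f := id) ⊥ ⊥
      (fun i hi _ _ ↦ (hfin.mem_toFinset.mp hi).isPrime)).mp
      (fun x hx ↦ by simpa using hcon x hx)
    rw [hfin.mem_toFinset] at hq
    have hQq : Q.asIdeal < q := lt_of_lt_of_le hQm hmq
    exact hQq.not_ge (hq.2 ⟨Q.isPrime, by simpa [Ideal.span_le] using hfQ⟩ hQq.le)
  obtain ⟨x, hxm, hx⟩ := hx
  have hx0 : x ≠ 0 := by
    rintro rfl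
    obtain ⟨q, hq, -⟩ := Ideal.exists_minimalPrimes_le (I := Ideal.span {f}) (J := Q.asIdeal)
      (by simpa [Ideal.span_le] using hfQ)
    exact hx q hq q.zero_mem
  obtain ⟨q, hq, hqm⟩ := Ideal.exists_minimalPrimes_le (I := Ideal.span {x}) (J := m.asIdeal)
      (by simpa [Ideal.span_le] using hxm)
  have hqp := hq.isPrime
  have hxq : x ∈ q := hq.1.2 (Ideal.mem_span_singleton_self x)
  have hq1 := Ideal.height_le_one_of_isPrincipal_of_mem_minimalPrimes _ q hq
  have no_chain (I J : Ideal A) (hI : I.IsPrime) (hJ : J.IsPrime) (hI0 : I ≠ ⊥) (hIJ : I < J)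
      (hJ1 : J.height ≤ 1) : False := by
    have := Ideal.height_le_iff (n := 1).mp hJ1 I hI hIJ
    rw [Nat.cast_one, Order.lt_one_iff, Ideal.height_eq_zero_iff_eq_bot] at this
    exact hI0 this
  have hqm' : q < m.asIdeal := by
    refine lt_of_le_of_ne hqm fun e ↦ ?_
    subst e
    exact no_chain Q.asIdeal _ Q.isPrime hqp (hne _ Q.isPrime hf hfQ) hQm hq1
  have hfq : f ∈ q := h ⟨q, hqp⟩ (fun e ↦ hne q hqp hx0 hxq (congr_arg asIdeal e)) hqm'
  obtain ⟨r, hr, hrq⟩ := Ideal.exists_minimalPrimes_le (I := Ideal.span {f}) (J := q)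
      (by simpa [Ideal.span_le] using hfq)
  have hrp := hr.isPrime
  refine no_chain r q hrp hqp (hne r hrp hf (hr.1.2 (Ideal.mem_span_singleton_self f)))
    (lt_of_le_of_ne hrq ?_) hq1
  rintro rfl
  exact hx _ hr hxq

theorem PrimeSpectrum.exists_covBy_notMem {A : Type*} [CommRing A] [IsDomain A]
    [IsNoetherianRing A] (m : PrimeSpectrum A) (hm : m ≠ ⊥) {f : A} (hf : f ≠ 0) :
    ∃ P : PrimeSpectrum A, P ⋖ m ∧ f ∉ P.asIdeal := by
  have : WellFoundedGT (PrimeSpectrum A) :=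
    StrictMono.wellFoundedGT (f := PrimeSpectrum.asIdeal) fun _ _ h ↦ h
  let S : Set (PrimeSpectrum A) := {Q | Q < m ∧ f ∉ Q.asIdeal}
  have hS : S.Nonempty := ⟨⊥, bot_lt_iff_ne_bot.mpr hm, hf⟩
  obtain ⟨P, ⟨hPm, hfP⟩, hP⟩ :=
    WellFounded.has_min (wellFounded_gt (α := PrimeSpectrum A)) S hS
  refine ⟨P, ?_, hfP⟩
  obtain ⟨m, rfl⟩ := exists_comap_mk_eq (I := P.asIdeal) hPm.le
  nth_rw 1 [← comap_mk_bot P]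
  rw [comap_mk_covBy_comap_mk_iff]
  have hmono {q q' : PrimeSpectrum (A ⧸ P.asIdeal)} : comap (Ideal.Quotient.mk P.asIdeal) q <
      comap (Ideal.Quotient.mk P.asIdeal) q' ↔ q < q' :=
    P.asIdeal.primeSpectrumQuotientOrderIsoZeroLocus.lt_iff_lt
  refine bot_covBy_of_forall_mem m ?_ (f := Ideal.Quotient.mk _ f)
    (by rwa [Ne, Ideal.Quotient.eq_zero_iff_mem]) fun q hq hqm ↦ ?_
  · rintro rfl
    rw [comap_mk_bot] at hPm
    exact hPm.false
  · by_contra hfq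
    refine hP (comap (Ideal.Quotient.mk _) q) ⟨hmono.mpr hqm, hfq⟩ ?_
    exact (comap_mk_bot P).symm.trans_lt <| hmono.mpr (bot_lt_iff_ne_bot.mpr hq)

instance ProjectiveSpace.locallyOfFiniteType_structureMap (k : Type) [Field k] (n : ℕ) :
    LocallyOfFiniteType (structureMap k n) := by
  have : IsScalarTower k (MvPolynomial.homogeneousSubmodule (Fin (n + 1)) k 0)
      (MvPolynomial (Fin (n + 1)) k) := ⟨fun a b c ↦ smul_mul_assoc a b.1 c⟩
  have : Algebra.FiniteType (MvPolynomial.homogeneousSubmodule (Fin (n + 1)) k 0)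
      (MvPolynomial (Fin (n + 1)) k) := .of_restrictScalars_finiteType k _ _
  have hsurj : Function.Surjective
      (algebraMap k (MvPolynomial.homogeneousSubmodule (Fin (n + 1)) k 0)) := by
    rintro ⟨a, ha⟩
    rw [MvPolynomial.homogeneousSubmodule_zero, Submodule.mem_one] at ha
    obtain ⟨c, rfl⟩ := ha
    exact ⟨c, rfl⟩
  have h₂ : LocallyOfFiniteType (Spec.map (CommRingCat.ofHom
      (algebraMap k (MvPolynomial.homogeneousSubmodule (Fin (n + 1)) k 0)))) :=
    (HasRingHomProperty.Spec_iff (P := @LocallyOfFiniteType)).mpr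
      (RingHom.FiniteType.of_surjective _ hsurj)
  have h₁ : LocallyOfFiniteType
      (Proj.toSpecZero (MvPolynomial.homogeneousSubmodule (Fin (n + 1)) k)) := inferInstance
  exact MorphismProperty.comp_mem (W := @LocallyOfFiniteType) _ _ h₁ h₂

section

variable {α : Type*} [TopologicalSpace α] [QuasiSober α] [T0Space α]

theorem one_le_topologicalKrullDim_iff :
    1 ≤ topologicalKrullDim α ↔ ∃ x y : α, x ≠ y ∧ y ⤳ x := by
  let _ : PartialOrder α := specializationOrder α
  rw [topologicalKrullDim, Order.krullDim_eq_of_orderIso (irreducibleSetEquivPoints (α := α)),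
    Order.one_le_krullDim_iff]
  simp_rw [lt_iff_le_and_ne, and_comm]
  rfl

theorem topologicalKrullDim_le_one_iff :
    topologicalKrullDim α ≤ 1 ↔
      ∀ x : α, (∀ y, x ⤳ y → y ⤳ x) ∨ (∀ y, y ⤳ x → x ⤳ y) := by
  let _ : PartialOrder α := specializationOrder α
  rw [topologicalKrullDim, Order.krullDim_eq_of_orderIso (irreducibleSetEquivPoints (α := α)),
    Order.krullDim_le_one_iff]
  rfl

end

namespace AlgebraicGeometry

variable {X : Scheme.{0}}

theorem Scheme.Hom.covBy_iff_of_isOpenImmersion {R : CommRingCat} (f : Spec R ⟶ X)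
    [IsOpenImmersion f] {y y' : PrimeSpectrum R} :
    (f (y : Spec R) : X) ⋖ f (y' : Spec R) ↔ y' ⋖ y := by
  let e : Spec R ↪o X :=
    ⟨⟨f, f.isOpenEmbedding.injective⟩, f.isOpenEmbedding.isInducing.specializes_iff⟩
  have hc : (Set.range e).OrdConnected :=
    ⟨fun a ha b hb c hc ↦ hc.1.mem_open f.isOpenEmbedding.isOpen_range ha⟩
  have hspec : OrderDual.toDual y ⋖ OrderDual.toDual y' ↔
      @CovBy (Spec R) _ y y' :=
    apply_covBy_apply_iff (specOrderIsoPrimeSpectrum R)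
  exact (Set.OrdConnected.apply_covBy_apply_iff e hc).trans
    (hspec.symm.trans toDual_covBy_toDual_iff)

theorem LocallyOfFiniteType.covBy_of_isClosed {k : Type} [Field k]
    (sX : X ⟶ Spec (CommRingCat.of k)) [LocallyOfFiniteType sX] {p q x : X}
    (hp : IsClosed {p}) (hq : IsClosed {q}) (hpx : p ⋖ x) (hqx : q ≤ x) : q ⋖ x := by
  have : JacobsonSpace X := LocallyOfFiniteType.jacobsonSpace sX
  have key {R : CommRingCat} (f : Spec R ⟶ X) [IsOpenImmersion f] {a b : X}
      (ha : a ∈ Set.range f) (hb : b ∈ Set.range f) (hac : IsClosed {a}) (hbc : IsClosed {b})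
      (hax : a ⋖ x) (hbx : b ≤ x) : b ⋖ x := by
    have hx : x ∈ Set.range f := hax.le.mem_open f.isOpenEmbedding.isOpen_range ha
    obtain ⟨a, rfl⟩ := ha
    obtain ⟨b, rfl⟩ := hb
    obtain ⟨x, rfl⟩ := hx
    let φ : k →+* R := (Spec.preimage (f ≫ sX)).hom
    have hφ : φ.FiniteType := by
      have : LocallyOfFiniteType (Spec.map (Spec.preimage (f ≫ sX))) := by
        rw [Spec.map_preimage]; infer_instance
      exact (HasRingHomProperty.Spec_iff (P := @LocallyOfFiniteType)).mp this
    algebraize [φ]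
    have hmax (c : PrimeSpectrum R) (hc : IsClosed {(f (c : Spec R) : X)}) :
        c.asIdeal.IsMaximal := by
      rw [← PrimeSpectrum.isClosed_singleton_iff_isMaximal]
      have h : f ⁻¹' {f (c : Spec R)} = {(c : Spec R)} :=
        Set.ext fun z ↦ f.isOpenEmbedding.injective.eq_iff
      exact h ▸ hc.preimage f.continuous
    refine (Scheme.Hom.covBy_iff_of_isOpenImmersion f).mpr <|
      PrimeSpectrum.covBy_of_isMaximal k ((Scheme.Hom.covBy_iff_of_isOpenImmersion f).mp hax)
      (hmax a hac) (hmax b hbc) <|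
      (PrimeSpectrum.le_iff_specializes x b).mpr <|
        f.isOpenEmbedding.isInducing.specializes_iff.mp hbx
  obtain ⟨R, f, hf, hpf, -⟩ := Scheme.exists_affine_mem_range_and_range_subset
    (show p ∈ (⊤ : X.Opens) from trivial)
  obtain ⟨S, g, hg, hqg, -⟩ := Scheme.exists_affine_mem_range_and_range_subset
    (show q ∈ (⊤ : X.Opens) from trivial)
  obtain ⟨c, ⟨⟨hcf, hcg⟩, hcx⟩, hc⟩ := nonempty_inter_closedPoints
    (Z := Set.range f ∩ Set.range g ∩ closure {x})
    ⟨x, ⟨hpx.le.mem_open f.isOpenEmbedding.isOpen_range hpf,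
      hqx.mem_open g.isOpenEmbedding.isOpen_range hqg⟩, subset_closure rfl⟩
    ((f.isOpenEmbedding.isOpen_range.inter g.isOpenEmbedding.isOpen_range).isLocallyClosed.inter
      isClosed_closure.isLocallyClosed)
  rw [← specializes_iff_mem_closure] at hcx
  exact key g hcg hqg hc hq (key f hpf hcf hp hc hpx hcx) hqx

theorem exists_mem_covBy [IsIntegral X] [IsLocallyNoetherian X] {p : X} (hp : p ≠ ⊤)
    {U : Set X} (hU : IsOpen U) (hne : U.Nonempty) : ∃ x ∈ U, p ⋖ x := by
  obtain ⟨R, f, hf, ⟨p, rfl⟩, -⟩ := Scheme.exists_affine_mem_range_and_range_subset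
    (show p ∈ (⊤ : X.Opens) from trivial)
  have : Nonempty (Spec R) := ⟨p⟩
  have : IsIntegral (Spec R) := isIntegral_of_isOpenImmersion f
  have : IsDomain R := (affine_isIntegral_iff R).mp inferInstance
  have : IsLocallyNoetherian (Spec R) := isLocallyNoetherian_of_isOpenImmersion f
  have : IsNoetherianRing R := isLocallyNoetherian_Spec.mp inferInstance
  have htop : (f ((⊥ : PrimeSpectrum R) : Spec R) : X) = ⊤ := by
    rw [← genericPoint_eq_bot_of_affine]
    exact genericPoint_eq_of_isOpenImmersion f
  obtain ⟨u, hu⟩ := hne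
  have hbotU : f ((⊥ : PrimeSpectrum R) : Spec R) ∈ U := htop ▸ (le_top (a := u)).mem_open hU hu
  obtain ⟨_, ⟨g, rfl⟩, hg, hgU⟩ :=
    PrimeSpectrum.isTopologicalBasis_basic_opens.exists_subset_of_mem_open hbotU
      (hU.preimage f.continuous)
  obtain ⟨P, hP, hgP⟩ := PrimeSpectrum.exists_covBy_notMem (p : PrimeSpectrum R)
    (fun h ↦ hp (htop ▸ congr_arg f h)) (f := g) (fun h ↦ hg (h ▸ Ideal.zero_mem _))
  exact ⟨f (P : Spec R), hgU hgP, (Scheme.Hom.covBy_iff_of_isOpenImmersion f).mpr hP⟩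

theorem topologicalKrullDim_closure_singleton_eq_one [JacobsonSpace X] {p x : X} (hpx : p < x)
    (h : ∀ q, IsClosed {q} → q < x → q ⋖ x) : topologicalKrullDim (closure {x} : Set X) = 1 := by
  have hemb : Topology.IsClosedEmbedding (Subtype.val : closure {x} → X) :=
    isClosed_closure.isClosedEmbedding_subtypeVal
  have : QuasiSober (closure {x} : Set X) := hemb.quasiSober
  apply le_antisymm
  · refine (topologicalKrullDim_le_one_iff (α := closure {x})).mpr fun ⟨y, hy⟩ ↦ ?_
    replace hy : y ≤ x := specializes_iff_mem_closure.mpr hy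
    by_cases hxy : x = y
    · subst hxy
      exact .inr fun ⟨z, hz⟩ _ ↦ hemb.isInducing.specializes_iff.mp
        (specializes_iff_mem_closure.mpr hz)
    obtain ⟨q, hq, hqc⟩ := nonempty_inter_closedPoints (Z := closure {y})
      ⟨y, subset_closure rfl⟩ isClosed_closure.isLocallyClosed
    replace hq : q ≤ y := specializes_iff_mem_closure.mpr hq
    have hyx : y < x := lt_of_le_not_ge hy fun h ↦ hxy (Specializes.antisymm hy h).eq
    have hqy : q = y := by
      by_contra hqy
      have hqy' : q < y := lt_of_le_not_ge hq fun h ↦ hqy (Specializes.antisymm h hq).eq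
      exact (h q hqc (hqy'.trans hyx)).2 hqy' hyx
    subst hqy
    refine .inl fun ⟨z, hz⟩ hqz ↦ ?_
    have hqz' : q ⤳ z := hemb.isInducing.specializes_iff.mpr hqz
    rw [specializes_iff_mem_closure, (show IsClosed {q} from hqc).closure_eq] at hqz'
    subst hqz'
    rfl
  · exact (one_le_topologicalKrullDim_iff (α := closure {x})).mpr
      ⟨⟨p, specializes_iff_mem_closure.mp hpx.le⟩, ⟨x, subset_closure rfl⟩,
        fun h ↦ hpx.ne (congr_arg Subtype.val h), hemb.isInducing.specializes_iff.mp hpx.le⟩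

end AlgebraicGeometry

/-- **Kempf's curve lemma.** Let `X` be an integral quasi-projective scheme of
dimension at least `1` over an algebraically closed field `k`, let `U` be a nonempty open
subset of `X` and let `p` be a closed point of `X`. Then there is an irreducible closed subset
`C` of `|X|` of topological Krull dimension `1` passing through `p` and meeting `U`. -/
theorem kempf_curve_lemma (k : Type) [Field k] [IsAlgClosed k]
    (X : Scheme) [IsIntegral X] (sX : X ⟶ Spec (CommRingCat.of k))
    (hqp : IsQuasiProjectiveOver k sX)
    (hdim : 1 ≤ topologicalKrullDim X.carrier)
    (U : Set X.carrier) (hU : IsOpen U) (hUne : U.Nonempty)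
    (p : X.carrier) (hp : IsClosed ({p} : Set X.carrier)) :
    ∃ C : Set X.carrier, IsClosed C ∧ IsIrreducible C ∧
      topologicalKrullDim C = 1 ∧ p ∈ C ∧ (C ∩ U).Nonempty := by
  obtain ⟨n, i, hi, rfl⟩ := hqp
  have : LocallyOfFiniteType (i ≫ ProjectiveSpace.structureMap k n) := inferInstance
  have : JacobsonSpace X := LocallyOfFiniteType.jacobsonSpace (i ≫ ProjectiveSpace.structureMap k n)
  have : IsLocallyNoetherian X :=
    LocallyOfFiniteType.isLocallyNoetherian (i ≫ ProjectiveSpace.structureMap k n)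
  have hp_top : p ≠ ⊤ := by
    rintro rfl
    obtain ⟨x, y, hxy, -⟩ := one_le_topologicalKrullDim_iff.mp hdim
    have h (z : X) : z = ⊤ := by
      have : z ∈ closure {(⊤ : X)} := specializes_iff_mem_closure.mp (le_top (a := z))
      rwa [hp.closure_eq] at this
    exact hxy ((h x).trans (h y).symm)
  obtain ⟨x, hxU, hpx⟩ := exists_mem_covBy hp_top hU hUne
  exact ⟨closure {x}, isClosed_closure, isIrreducible_singleton.closure,
    topologicalKrullDim_closure_singleton_eq_one hpx.lt fun q hq hqx ↦
      LocallyOfFiniteType.covBy_of_isClosed (i ≫ ProjectiveSpace.structureMap k n) hp hq hpx hqx.le,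
    specializes_iff_mem_closure.mp hpx.le, x, subset_closure rfl, hxU⟩
end

section
/- Let k be an algebraically closed field of characteristic 0, let H be an integral quasi-projective scheme over k, let U be a nonempty open subset of H, and let h be a closed point of H with h ∉ U. Then there exist an integral affine scheme C of dimension 1 which is smooth over k, a k-morphism g : C → H, and a closed point c ∈ C such that g(c) = h and the image under g of the generic point of C lies in U. -/
open AlgebraicGeometry CategoryTheory

attribute [local instance] MvPolynomial.gradedAlgebra

open MvPolynomial in
theorem exists_surjective_line {k σ : Type*} [Field k] [IsAlgClosed k] [Finite σ]
    (M : Ideal (MvPolynomial σ k)) [M.IsMaximal] {F : MvPolynomial σ k} (hF : F ≠ 0) (hFM : F ∈ M) :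
    ∃ l : MvPolynomial σ k →ₐ[k] Polynomial k,
      Function.Surjective l ∧ l F ≠ 0 ∧ RingHom.ker l ≤ M := by
  obtain ⟨a, rfl⟩ := eq_vanishingIdeal_singleton_of_isMaximal k (I := M) inferInstance
  rw [mem_vanishingIdeal_singleton_iff] at hFM
  obtain ⟨b, hb⟩ : ∃ b : σ → k, aeval b F ≠ 0 := by
    by_contra! H
    exact hF (MvPolynomial.funext fun x => by simpa [aeval_eq_eval] using H x)
  let l : MvPolynomial σ k →ₐ[k] Polynomial k :=
    aeval fun i => Polynomial.C (a i) + Polynomial.C (b i - a i) * Polynomial.X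
  have hl (t : k) : (Polynomial.aeval t).comp l = aeval fun i => a i + (b i - a i) * t := by
    ext i
    simp [l]
  refine ⟨l, ?_, ?_, ?_⟩
  · obtain ⟨i, hi⟩ : ∃ i, a i ≠ b i := by
      by_contra! H
      exact hb (funext H ▸ hFM)
    have hi' : b i - a i ≠ 0 := sub_ne_zero.mpr hi.symm
    intro r
    refine ⟨Polynomial.aeval (C (b i - a i)⁻¹ * (X i - C (a i))) r, ?_⟩
    rw [← Polynomial.aeval_algHom_apply]
    have : l (C (b i - a i)⁻¹ * (X i - C (a i))) = Polynomial.X := by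
      simp only [l, map_mul, map_sub l, aeval_X, MvPolynomial.algHom_C, Polynomial.algebraMap_eq,
        add_sub_cancel_left, ← mul_assoc, ← Polynomial.C_mul,
        inv_mul_cancel₀ hi', Polynomial.C_1, one_mul]
    rw [this, Polynomial.aeval_X_left_apply]
  · intro h0
    have := DFunLike.congr_fun (hl 1) F
    simp [h0] at this
    exact hb (by simpa [aeval_eq_eval] using this.symm)
  · intro q hq
    rw [mem_vanishingIdeal_singleton_iff]
    have := DFunLike.congr_fun (hl 0) q
    rw [RingHom.mem_ker] at hq
    have hq' : l q = 0 := hq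
    simp [hq'] at this
    simpa [aeval_eq_eval] using this.symm

theorem exists_isPrime_le_and_integral_polynomial {k A : Type*} [Field k] [IsAlgClosed k]
    [CommRing A] [IsDomain A] [Algebra k A] [Algebra.FiniteType k A]
    (m : Ideal A) [m.IsMaximal] {f : A} (hf : f ≠ 0) (hfm : f ∈ m) :
    ∃ p : Ideal A, p.IsPrime ∧ p ≤ m ∧ f ∉ p ∧ ∃ φ : Polynomial k →ₐ[k] A ⧸ p,
      Function.Injective φ ∧ φ.toRingHom.IsIntegral := by
  obtain ⟨s, g, hg, hgi⟩ := exists_integral_inj_algHom_of_fg k A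
  algebraize [g.toRingHom]
  have hint : Algebra.IsIntegral (MvPolynomial (Fin s) k) A := ⟨hgi⟩
  have hfaith : FaithfulSMul (MvPolynomial (Fin s) k) A :=
    (faithfulSMul_iff_algebraMap_injective _ _).mpr hg
  obtain ⟨F, hF, hF0⟩ := Submodule.exists_mem_ne_zero_of_ne_bot
    (Ideal.comap_ne_bot_of_integral_mem (R := MvPolynomial (Fin s) k) hf
      (Ideal.mem_span_singleton_self f) (Algebra.IsIntegral.isIntegral f))
  have hfF : f ∣ g F := Ideal.mem_span_singleton.mp hF
  have hM : (m.under (MvPolynomial (Fin s) k)).IsMaximal := inferInstance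
  obtain ⟨l, hl, hlF, hlM⟩ := exists_surjective_line (m.under (MvPolynomial (Fin s) k)) hF0
    (m.mem_of_dvd hfF hfm)
  have : (RingHom.ker l).IsPrime := RingHom.ker_isPrime l
  obtain ⟨p, hpm, hp, hpl⟩ := Ideal.exists_ideal_le_liesOver_of_le m hlM
  have hpl' (q : MvPolynomial (Fin s) k) : g q ∈ p ↔ l q = 0 := by
    rw [← RingHom.mem_ker, hpl.over]; rfl
  refine ⟨p, hp, hpm, fun h => hlF ((hpl' F).mp (p.mem_of_dvd hfF h)), ?_⟩
  obtain ⟨x, hx⟩ := hl Polynomial.X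
  have hlx (r : Polynomial k) : l (Polynomial.aeval x r) = r := by
    rw [← Polynomial.aeval_algHom_apply, hx, Polynomial.aeval_X_left_apply]
  let φ := ((Ideal.Quotient.mkₐ k p).comp g).comp (Polynomial.aeval x)
  have hφ : φ.toRingHom.comp l.toRingHom = (Ideal.Quotient.mk p).comp g.toRingHom := by
    refine RingHom.ext fun q => Ideal.Quotient.eq.mpr ?_
    change g (Polynomial.aeval x (l q)) - g q ∈ p
    rw [← map_sub, hpl', map_sub, hlx, sub_self]
  refine ⟨φ, (injective_iff_map_eq_zero _).mpr fun r hr => ?_, ?_⟩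
  · rw [← hlx r, ← hpl']
    exact Ideal.Quotient.eq_zero_iff_mem.mp hr
  · refine RingHom.IsIntegral.tower_top l.toRingHom _ ?_
    rw [hφ]
    exact hgi.trans _ _ (RingHom.isIntegral_of_surjective _ Ideal.Quotient.mk_surjective)

theorem exists_span_singleton_eq_maximalIdeal_localization {D : Type*} [CommRing D]
    [IsDedekindDomain D] (c : Ideal D) [c.IsPrime] (hc : c ≠ ⊥) :
    ∃ t ∈ c, t ≠ 0 ∧ Ideal.span {algebraMap D (Localization.AtPrime c) t} =
      IsLocalRing.maximalIdeal (Localization.AtPrime c) := by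
  have := IsLocalization.AtPrime.isDiscreteValuationRing_of_dedekind_domain D hc
    (Localization.AtPrime c)
  obtain ⟨ϖ, hϖ⟩ := IsDiscreteValuationRing.exists_irreducible (Localization.AtPrime c)
  obtain ⟨t, s, rfl⟩ := IsLocalization.exists_mk'_eq c.primeCompl ϖ
  have hts : Ideal.span {algebraMap D (Localization.AtPrime c) t} =
      IsLocalRing.maximalIdeal (Localization.AtPrime c) := by
    rw [(IsDiscreteValuationRing.irreducible_iff_uniformizer _).mp hϖ,
      Ideal.span_singleton_eq_span_singleton, ← IsLocalization.mk'_spec _ t s]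
    exact associated_mul_unit_left _ _ (IsLocalization.map_units _ s)
  refine ⟨t, ?_, ?_, hts⟩
  · rw [← IsLocalization.AtPrime.to_map_mem_maximal_iff (Localization.AtPrime c) c, ← hts]
    exact Ideal.mem_span_singleton_self _
  · rintro rfl
    exact hϖ.ne_zero (by simp)

open Polynomial in
theorem isSmoothAt_of_isDedekindDomain {k D : Type*} [Field k] [IsAlgClosed k] [CharZero k]
    [CommRing D] [IsDedekindDomain D] [Algebra k D] [Algebra.FiniteType k D]
    (c : Ideal D) [c.IsMaximal] (hc : c ≠ ⊥) : Algebra.IsSmoothAt k c := by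
  obtain ⟨t, htc, ht0, hspan⟩ := exists_span_singleton_eq_maximalIdeal_localization c hc
  let ψ : k[X] →ₐ[k] D := aeval t
  algebraize [ψ.toRingHom]
  have hX : algebraMap k[X] D X = t := aeval_X t
  have hXmax : (Ideal.span {(X : k[X])}).IsMaximal :=
    PrincipalIdealRing.isMaximal_of_irreducible irreducible_X
  have hover : c.LiesOver (Ideal.span {(X : k[X])}) := by
    refine ⟨hXmax.eq_of_le Ideal.IsPrime.ne_top' ?_⟩
    rw [Ideal.span_singleton_le_iff_mem]
    change algebraMap k[X] D X ∈ c
    rwa [hX]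
  have hinj : Function.Injective (algebraMap k[X] D) := by
    rw [RingHom.injective_iff_ker_eq_bot]
    by_contra hker
    have hle : RingHom.ker (algebraMap k[X] D) ≤ Ideal.span {X} := by
      rw [hover.over]
      exact Ideal.ker_le_comap _
    have := (RingHom.ker_isPrime (algebraMap k[X] D)).isMaximal hker
    have hXker : X ∈ RingHom.ker (algebraMap k[X] D) :=
      this.eq_of_le hXmax.ne_top hle ▸ Ideal.mem_span_singleton_self X
    exact ht0 (hX ▸ hXker)
  have : FaithfulSMul k[X] D := (faithfulSMul_iff_algebraMap_injective _ _).mpr hinj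
  have : Algebra.FiniteType k[X] D := .of_restrictScalars_finiteType k _ _
  have : Algebra.FinitePresentation k[X] D := Algebra.FinitePresentation.of_finiteType.mp this
  let := Localization.AtPrime.algebraOfLiesOver (Ideal.span {(X : k[X])}) c
  have : Algebra.IsUnramifiedAt k[X] c := by
    rw [Algebra.isUnramifiedAt_iff_map_eq _ (Ideal.span {(X : k[X])})]
    constructor
    · have : CharZero (Ideal.span {(X : k[X])}).ResidueField :=
        charZero_of_injective_algebraMap (algebraMap k _).injective
      let := Ideal.Quotient.field c
      have : Module.Finite k (D ⧸ c) := finite_of_finite_type_of_isJacobsonRing k (D ⧸ c)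
      have hfin : Module.Finite k c.ResidueField :=
        Module.Finite.of_surjective (IsScalarTower.toAlgHom k (D ⧸ c) c.ResidueField).toLinearMap
          (Ideal.bijective_algebraMap_quotient_residueField c).surjective
      have : IsScalarTower k (Ideal.span {(X : k[X])}).ResidueField c.ResidueField := inferInstance
      have := Algebra.IsAlgebraic.tower_top (K := k) (Ideal.span {(X : k[X])}).ResidueField
        (A := c.ResidueField)
      infer_instance
    · rw [Ideal.map_span, Set.image_singleton, IsScalarTower.algebraMap_apply k[X] D, hX, hspan]
  have : Algebra.IsEtaleAt k[X] c := .of_isUnramifiedAt_of_flat c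
  exact Algebra.FormallySmooth.comp k k[X] _

theorem ringKrullDim_eq_one_of_isDedekindDomain {D : Type*} [CommRing D]
    [IsDedekindDomain D] (hD : ¬ IsField D) : ringKrullDim D = 1 := by
  have : Ring.KrullDimLE 1 D := Ring.krullDimLE_one_iff_of_noZeroDivisors.mpr fun I hI hI' =>
    hI'.isMaximal hI
  refine le_antisymm (Ring.krullDimLE_iff.mp this) ?_
  rw [← not_lt]
  refine fun hlt => hD ?_
  have : Ring.KrullDimLE 0 D := Ring.krullDimLE_iff.mpr (Order.le_of_lt_succ hlt)
  exact Ring.KrullDimLE.isField_of_isDomain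

open Polynomial in
theorem exists_isDedekindDomain_of_integral_polynomial {k B : Type*} [Field k] [CharZero k]
    [CommRing B] [IsDomain B] [Algebra k B] [Algebra.FiniteType k B]
    (φ : k[X] →ₐ[k] B) (hφ : Function.Injective φ) (hφi : φ.toRingHom.IsIntegral) :
    ∃ (D : Subalgebra k (FractionRing B)),
      IsDedekindDomain D ∧ Algebra.FiniteType k D ∧ ∃ ι : B →ₐ[k] D,
        Function.Injective ι ∧ ι.toRingHom.IsIntegral := by
  algebraize [φ.toRingHom]
  have : Algebra.IsIntegral k[X] B := ⟨hφi⟩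
  have : FaithfulSMul k[X] B := (faithfulSMul_iff_algebraMap_injective _ _).mpr hφ
  have : Algebra.FiniteType k[X] B := .of_restrictScalars_finiteType k _ _
  have : Module.Finite k[X] B := Algebra.IsIntegral.finite
  have : FaithfulSMul k[X] (FractionRing B) := .trans _ B _
  let := FractionRing.liftAlgebra k[X] (FractionRing B)
  have : FiniteDimensional (FractionRing k[X]) (FractionRing B) := inferInstance
  have : CharZero (FractionRing k[X]) := charZero_of_injective_algebraMap (algebraMap k _).injective
  let E := integralClosure k[X] (FractionRing B)
  have : Module.Finite k[X] E :=
    IsIntegralClosure.finite k[X] (FractionRing k[X]) (FractionRing B) _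
  have : Algebra.FiniteType k E := .trans (S := k[X]) inferInstance inferInstance
  let ι : B →ₐ[k[X]] E := IsIntegralClosure.lift k[X] E (FractionRing B)
  have hι (b : B) : (ι b : FractionRing B) = algebraMap B _ b :=
    IsIntegralClosure.algebraMap_lift k[X] E (FractionRing B) b
  refine ⟨E.restrictScalars k, inferInstanceAs (IsDedekindDomain E),
    inferInstanceAs (Algebra.FiniteType k E), ι.restrictScalars k, ?_, ?_⟩
  · exact fun x y hxy => IsFractionRing.injective B (FractionRing B) (by
      rw [← hι, ← hι]; exact congrArg Subtype.val hxy)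
  · refine RingHom.IsIntegral.tower_top (algebraMap k[X] B) _ ?_
    have : (ι : B →+* E).comp (algebraMap k[X] B) = algebraMap k[X] E := ι.comp_algebraMap
    change ((ι : B →+* E).comp (algebraMap k[X] B)).IsIntegral
    rw [this]
    exact Algebra.IsIntegral.isIntegral (R := k[X]) (A := E)

theorem exists_smooth_algebra_of_isMaximal {k A : Type} [Field k] [IsAlgClosed k] [CharZero k]
    [CommRing A] [IsDomain A] [Algebra k A] [Algebra.FiniteType k A]
    (m : Ideal A) [m.IsMaximal] {f : A} (hf : f ≠ 0) (hfm : f ∈ m) :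
    ∃ (D : Type) (_ : CommRing D) (_ : IsDomain D) (_ : Algebra k D) (φ : A →ₐ[k] D) (c : Ideal D),
      Algebra.Smooth k D ∧ ringKrullDim D = 1 ∧ c.IsMaximal ∧ c.comap φ = m ∧ φ f ≠ 0 := by
  obtain ⟨p, hp, hpm, hfp, φ, hφ, hφi⟩ := exists_isPrime_le_and_integral_polynomial (k := k) m hf hfm
  obtain ⟨D, hD, hDft, ι, hι, hιi⟩ := exists_isDedekindDomain_of_integral_polynomial φ hφ hφi
  algebraize [ι.toRingHom]
  have : Algebra.IsIntegral (A ⧸ p) D := ⟨hιi⟩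
  have hmp : (m.map (Ideal.Quotient.mk p)).IsMaximal :=
    Ideal.IsMaximal.map_of_surjective_of_ker_le Ideal.Quotient.mk_surjective (by simpa)
  obtain ⟨c, hc, hcm⟩ := Ideal.exists_ideal_over_maximal_of_isIntegral (S := D)
    (m.map (Ideal.Quotient.mk p))
    (by rw [(RingHom.injective_iff_ker_eq_bot _).mp (show Function.Injective (algebraMap (A ⧸ p) D) from hι)]; exact bot_le)
  let ψ : A →ₐ[k] D := ι.comp (Ideal.Quotient.mkₐ k p)
  have hψ : c.comap ψ = m := by
    change (c.comap (algebraMap (A ⧸ p) D)).comap (Ideal.Quotient.mk p) = m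
    rw [hcm, Ideal.comap_map_of_surjective' _ Ideal.Quotient.mk_surjective]
    simpa
  have hψf : ψ f ≠ 0 := fun h => hfp <| Ideal.Quotient.eq_zero_iff_mem.mp <| hι (h.trans (map_zero ι).symm)
  have hcbot : c ≠ ⊥ := by
    rintro rfl
    exact hψf (by rw [← hψ] at hfm; exact hfm)
  have : Algebra.FinitePresentation k D := Algebra.FinitePresentation.of_finiteType.mp hDft
  obtain ⟨_, ⟨_, ⟨g, rfl⟩, rfl⟩, hgc, hg⟩ :=
    PrimeSpectrum.isBasis_basic_opens.exists_subset_of_mem_open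
      (show ⟨c, hc.isPrime⟩ ∈ Algebra.smoothLocus k D from isSmoothAt_of_isDedekindDomain c hcbot)
      Algebra.isOpen_smoothLocus
  rw [Algebra.basicOpen_subset_smoothLocus_iff_smooth] at hg
  have hg0 : g ≠ 0 := fun h => hgc (h ▸ c.zero_mem)
  have hle : Submonoid.powers g ≤ nonZeroDivisors D := powers_le_nonZeroDivisors_of_noZeroDivisors hg0
  have hdisj : Disjoint (Submonoid.powers g : Set D) c :=
    (Ideal.disjoint_powers_iff_notMem g hc.isPrime.isRadical).mpr hgc
  let D' := Localization.Away g
  have : IsDomain D' := IsLocalization.isDomain_localization hle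
  have : IsDedekindDomain D' := IsLocalization.isDedekindDomain D hle D'
  let c' : Ideal D' := c.map (algebraMap D D')
  have hc'c : c'.comap (algebraMap D D') = c := IsLocalization.under_map_of_isPrime_disjoint _ _ hc.isPrime hdisj
  have hc'p : c'.IsPrime := IsLocalization.isPrime_of_isPrime_disjoint _ _ _ hc.isPrime hdisj
  have hc'bot : c' ≠ ⊥ := by
    intro h
    apply hcbot
    rw [← hc'c, h]
    exact Ideal.comap_bot_of_injective _ (IsLocalization.injective _ hle)
  refine ⟨D', inferInstance, inferInstance, inferInstance, (Algebra.algHom k D D').comp ψ, c', hg, ?_, hc'p.isMaximal hc'bot, ?_, ?_⟩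
  · exact ringKrullDim_eq_one_of_isDedekindDomain
      (Ring.not_isField_iff_exists_prime.mpr ⟨c', hc'bot, hc'p⟩)
  · rw [← hψ, ← hc'c]; rfl
  · intro h
    exact hψf (IsLocalization.injective D' hle (h.trans (map_zero _).symm))

theorem ProjectiveSpace.locallyOfFiniteType_structureMap_s11 (k : Type) [Field k] (n : ℕ) :
    LocallyOfFiniteType (ProjectiveSpace.structureMap k n) := by
  let 𝒜 := MvPolynomial.homogeneousSubmodule (Fin (n + 1)) k
  have : IsScalarTower k (𝒜 0) (MvPolynomial (Fin (n + 1)) k) :=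
    IsScalarTower.of_algebraMap_eq (R := k) (S := 𝒜 0) (A := MvPolynomial (Fin (n + 1)) k)
      fun _ => rfl
  have : Algebra.FiniteType (𝒜 0) (MvPolynomial (Fin (n + 1)) k) :=
    .of_restrictScalars_finiteType k _ _
  have hsurj : Function.Surjective (algebraMap k (𝒜 0)) := by
    rintro ⟨p, hp⟩
    obtain ⟨r, hr⟩ : ∃ r, p = MvPolynomial.C r :=
      ⟨_, (MvPolynomial.totalDegree_eq_zero_iff_eq_C).mp
        (Nat.le_zero.mp (MvPolynomial.IsHomogeneous.totalDegree_le hp))⟩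
    exact ⟨r, Subtype.ext hr.symm⟩
  have : LocallyOfFiniteType (Spec.map (CommRingCat.ofHom (algebraMap k (𝒜 0)))) :=
    (HasRingHomProperty.Spec_iff (P := @LocallyOfFiniteType)).mpr
      (RingHom.FiniteType.of_surjective _ hsurj)
  have : LocallyOfFiniteType (Proj.toSpecZero 𝒜) := inferInstance
  exact inferInstanceAs (LocallyOfFiniteType (Proj.toSpecZero 𝒜 ≫ _))

theorem IsQuasiProjectiveOver.locallyOfFiniteType {k : Type} [Field k] {X : Scheme}
    {sX : X ⟶ Spec (CommRingCat.of k)} (hX : IsQuasiProjectiveOver k sX) :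
    LocallyOfFiniteType sX := by
  obtain ⟨n, i, hi, rfl⟩ := hX
  have := ProjectiveSpace.locallyOfFiniteType_structureMap_s11 k n
  infer_instance

/-- Let `k` be an algebraically closed field of characteristic `0`, `H` an
integral quasi-projective scheme over `k`, `U` a nonempty open subset of `H` and `h` a closed
point of `H` not lying in `U`. Then there exist a smooth integral affine curve `C` over `k`,
a `k`-morphism `g : C ⟶ H` and a closed point `c ∈ C` with `g c = h` such that the image
under `g` of the generic point of `C` (i.e. of the point whose closure is all of `C`) lies
in `U`. -/
theorem exists_smooth_affine_curve_through_point_meeting_open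
    (k : Type) [Field k] [IsAlgClosed k] [CharZero k]
    (H : Scheme) [IsIntegral H] (sH : H ⟶ Spec (CommRingCat.of k))
    (hqp : IsQuasiProjectiveOver k sH)
    (U : Set H.carrier) (hU : IsOpen U) (hUne : U.Nonempty)
    (h : H.carrier) (hcl : IsClosed ({h} : Set H.carrier)) (hhU : h ∉ U) :
    ∃ (C : Scheme) (sC : C ⟶ Spec (CommRingCat.of k)) (g : C ⟶ H) (c : C.carrier),
      IsIntegral C ∧ IsAffine C ∧ topologicalKrullDim C.carrier = 1 ∧
      IsSmooth sC ∧ g ≫ sH = sC ∧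
      IsClosed ({c} : Set C.carrier) ∧ g.base c = h ∧
      ∃ ξ : C.carrier, closure ({ξ} : Set C.carrier) = Set.univ ∧ g.base ξ ∈ U := by
  have hft := hqp.locallyOfFiniteType
  obtain ⟨V, hV, hhV, -⟩ := exists_isAffineOpen_mem_and_subset (X := H) (U := ⊤) (x := h) trivial
  obtain ⟨x, hx⟩ : h ∈ Set.range hV.fromSpec := by rwa [hV.range_fromSpec]
  obtain ⟨ρ, hρ⟩ := Spec.map_surjective (hV.fromSpec ≫ sH)
  have hρft : ρ.hom.FiniteType := by
    rw [← HasRingHomProperty.Spec_iff (P := @LocallyOfFiniteType), hρ]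
    infer_instance
  have : Nonempty V := ⟨⟨h, hhV⟩⟩
  let _ : Algebra k Γ(H, V) := ρ.hom.toAlgebra
  have : Algebra.FiniteType k Γ(H, V) := hρft
  have hxm : x.asIdeal.IsMaximal := by
    refine (PrimeSpectrum.isClosed_singleton_iff_isMaximal x).mp ?_
    have hclosed := hcl.preimage hV.fromSpec.continuous
    rwa [← hx, ← Set.image_singleton,
      hV.fromSpec.isOpenEmbedding.injective.preimage_image] at hclosed
  obtain ⟨y, hyV, hyU⟩ := nonempty_preirreducible_inter V.isOpen hU ⟨h, hhV⟩ hUne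
  obtain ⟨y, rfl⟩ : y ∈ Set.range hV.fromSpec := by rwa [hV.range_fromSpec]
  obtain ⟨_, ⟨_, ⟨f, rfl⟩, rfl⟩, hfy, hfU⟩ :=
    PrimeSpectrum.isBasis_basic_opens.exists_subset_of_mem_open
      (show y ∈ hV.fromSpec ⁻¹' U from hyU) (hU.preimage hV.fromSpec.continuous)
  have hf0 : f ≠ 0 := fun h0 => hfy (h0 ▸ y.asIdeal.zero_mem)
  have hfx : f ∈ x.asIdeal := by
    by_contra hfx
    exact hhU (hx ▸ hfU hfx)
  obtain ⟨D, _, _, _, φ, c, hD, hdim, hc, hcx, hφf⟩ :=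
    exists_smooth_algebra_of_isMaximal (k := k) x.asIdeal hf0 hfx
  have hφ : ρ ≫ CommRingCat.ofHom φ.toRingHom = CommRingCat.ofHom (algebraMap k D) := by
    ext r
    exact φ.commutes r
  refine ⟨Spec (.of D), Spec.map (CommRingCat.ofHom (algebraMap k D)),
    Spec.map (CommRingCat.ofHom φ.toRingHom) ≫ hV.fromSpec, ⟨c, hc.isPrime⟩,
    inferInstance, inferInstance, ?_, ?_, ?_, ?_, ?_, ⟨⊥, Ideal.isPrime_bot⟩, ?_, ?_⟩
  · exact PrimeSpectrum.topologicalKrullDim_eq_ringKrullDim D |>.trans hdim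
  · exact (HasRingHomProperty.Spec_iff (P := @Smooth)).mpr (RingHom.smooth_algebraMap.mpr hD)
  · rw [Category.assoc, ← hρ, ← Spec.map_comp, hφ]
  · exact (PrimeSpectrum.isClosed_singleton_iff_isMaximal _).mpr hc
  · rw [← hx]
    exact congrArg hV.fromSpec (PrimeSpectrum.ext hcx)
  · exact (PrimeSpectrum.closure_singleton _).trans PrimeSpectrum.zeroLocus_bot
  · exact hfU fun hmem => hφf (Ideal.mem_bot.mp hmem)
end
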